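/- For the maximally mixed state I/d² on C^d ⊗ C^d with d ≥ 2, the entropic entanglement parameter is strictly negative: M(I/d²) ≤ −log₂ d + (1 − 1/d)·log₂(d + 1) < 0. -/

import Mathlib

open Matrix Kronecker BigOperators ComplexOrder

noncomputable section

namespace EEP

/-- `-(x * log₂ x)`; note `Real.logb 2 0 = 0`, giving the convention `0·log₂ 0 = 0`. -/
def negMulLog2 (x : ℝ) : ℝ := -(x * Real.logb 2 x)

/-- Shannon entropy (base 2) of a finite family of reals. -/
def shannon {n : Type*} [Fintype n] (p : n → ℝ) : ℝ := ∑ i, negMulLog2 (p i)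

/-- A quantum state: positive semidefinite (hence Hermitian) matrix with trace 1. -/
def IsState {n : Type*} [Fintype n] [DecidableEq n] (ρ : Matrix n n ℂ) : Prop :=
  ρ.PosSemidef ∧ ρ.trace = 1

/-- A rank-one orthogonal projection matrix. -/
def IsRankOneProj {n : Type*} [Fintype n] [DecidableEq n] (P : Matrix n n ℂ) : Prop :=
  P.IsHermitian ∧ P * P = P ∧ P.rank = 1

/-- A von Neumann measurement on `C^d ⊗ C^d`: a family of `d²` rank-one orthogonal
projections, mutually orthogonal, summing to the identity. -/
def IsMeasurement {d : ℕ} (P : Fin (d^2) → Matrix (Fin d × Fin d) (Fin d × Fin d) ℂ) : Prop :=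
  (∀ i, IsRankOneProj (P i)) ∧ (∀ i j, i ≠ j → P i * P j = 0) ∧ (∑ i, P i) = 1

/-- Klein entropy: Shannon entropy of the outcome distribution `pᵢ = Tr(ρ Pᵢ)`. -/
def kleinEntropy {d : ℕ} (ρ : Matrix (Fin d × Fin d) (Fin d × Fin d) ℂ)
    (P : Fin (d^2) → Matrix (Fin d × Fin d) (Fin d × Fin d) ℂ) : ℝ :=
  shannon (fun i => (ρ * P i).trace.re)

/-- A product state: Kronecker product of two states on `C^d`. -/
def IsProductState {d : ℕ} (δ : Matrix (Fin d × Fin d) (Fin d × Fin d) ℂ) : Prop :=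
  ∃ σA σB : Matrix (Fin d) (Fin d) ℂ, IsState σA ∧ IsState σB ∧ δ = σA ⊗ₖ σB

/-- Infimum of the Klein entropy over product states, for a fixed measurement. -/
def infProd {d : ℕ} (P : Fin (d^2) → Matrix (Fin d × Fin d) (Fin d × Fin d) ℂ) : ℝ :=
  sInf {x : ℝ | ∃ δ, IsProductState δ ∧ x = kleinEntropy δ P}

/-- The entropic entanglement parameter
`M(ρ) = sup_P ( inf_{δ product} H(δ,P) − H(ρ,P) )`. -/
def eep {d : ℕ} (ρ : Matrix (Fin d × Fin d) (Fin d × Fin d) ℂ) : ℝ :=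
  sSup {x : ℝ | ∃ P, IsMeasurement P ∧ x = infProd P - kleinEntropy ρ P}

/-- A separable state: finite convex combination of product states. -/
def IsSeparable {d : ℕ} (ρ : Matrix (Fin d × Fin d) (Fin d × Fin d) ℂ) : Prop :=
  ∃ (m : ℕ) (p : Fin m → ℝ) (δ : Fin m → Matrix (Fin d × Fin d) (Fin d × Fin d) ℂ),
    (∀ i, 0 ≤ p i) ∧ (∑ i, p i) = 1 ∧ (∀ i, IsProductState (δ i)) ∧
    ρ = ∑ i, (p i : ℂ) • δ i

/-- Rank-one projection `|v⟩⟨v|` onto a vector `v`. -/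
def projVec {n : Type*} (v : n → ℂ) : Matrix n n ℂ := Matrix.vecMulVec v (star v)

/-- Coefficient matrix `A` of a vector `ψ ∈ C^d ⊗ C^d`, `A i j = ψ (i,j)`. -/
def coeffMat {d : ℕ} (ψ : Fin d × Fin d → ℂ) : Matrix (Fin d) (Fin d) ℂ :=
  Matrix.of fun i j => ψ (i, j)

/-- The squared Schmidt coefficients of `ψ`: the eigenvalues of `A Aᴴ`
where `A` is the coefficient matrix of `ψ`. -/
def schmidtSq {d : ℕ} (ψ : Fin d × Fin d → ℂ) : Fin d → ℝ :=
  (Matrix.isHermitian_mul_conjTranspose_self (coeffMat ψ)).eigenvalues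

/-- Largest squared Schmidt coefficient (square of the largest singular value of `A`). -/
def maxSchmidtSq {d : ℕ} (ψ : Fin d × Fin d → ℂ) : ℝ := ⨆ i, schmidtSq ψ i

/-- A unit vector. -/
def IsUnitVec {n : Type*} [Fintype n] (ψ : n → ℂ) : Prop := (∑ p, Complex.normSq (ψ p)) = 1

/-- A maximally entangled unit vector: all squared Schmidt coefficients equal `1/d`. -/
def IsMaxEntVec {d : ℕ} (ψ : Fin d × Fin d → ℂ) : Prop :=
  IsUnitVec ψ ∧ ∀ i, schmidtSq ψ i = 1 / d

/-- A von Neumann measurement in a maximally entangled basis. -/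
def IsMaxEntMeasurement {d : ℕ}
    (P : Fin (d^2) → Matrix (Fin d × Fin d) (Fin d × Fin d) ℂ) : Prop :=
  IsMeasurement P ∧ ∀ i, ∃ ψ, IsMaxEntVec ψ ∧ P i = projVec ψ

/-- Von Neumann entropy: Shannon entropy of the eigenvalues. -/
def vnEntropy {n : Type*} [Fintype n] [DecidableEq n] {ρ : Matrix n n ℂ}
    (h : ρ.IsHermitian) : ℝ := shannon h.eigenvalues

/-- Binary Shannon entropy. -/
def binEnt (x : ℝ) : ℝ := negMulLog2 x + negMulLog2 (1 - x)

lemma rankOne_facts {n : Type*} [Fintype n] [DecidableEq n] {P : Matrix n n ℂ}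
    (h : IsRankOneProj P) :
    P.trace = 1 ∧ (∀ x y, P x y * P y x = P x x * P y y) ∧ P.PosSemidef := by
  obtain ⟨hH, hI, hR⟩ := h
  have hab : ∃ a b : n → ℂ, ∀ x y, P x y = a x * b y := by
    unfold Matrix.rank at hR
    obtain ⟨v, -, hv⟩ := finrank_eq_one_iff'.1 hR
    choose c hc using hv
    refine ⟨v.1, fun y => c ⟨P.mulVecLin (Pi.single y 1), LinearMap.mem_range_self _ _⟩, ?_⟩
    intro x y
    have := congrArg (fun w => w.1 x)
      (hc ⟨P.mulVecLin (Pi.single y 1), LinearMap.mem_range_self _ _⟩)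
    simp at this
    rw [mul_comm, ← this]
    simp
  obtain ⟨a, b, hab⟩ := hab
  refine ⟨?_, ?_, ?_⟩
  · have hne : P ≠ 0 := by
      rintro rfl
      simp at hR
    have : ∃ x y, P x y ≠ 0 := by
      by_contra hc
      push Not at hc
      exact hne (by ext x y; simpa using hc x y)
    obtain ⟨x, y, hxy⟩ := this
    have h1 : (P * P) x y = P.trace * P x y := by
      simp only [Matrix.mul_apply, Matrix.trace, Matrix.diag, hab, Finset.sum_mul]
      exact Finset.sum_congr rfl fun k _ => by ring
    rw [hI] at h1
    have h2 : (P.trace - 1) * P x y = 0 := by linear_combination -h1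
    rcases mul_eq_zero.1 h2 with h | h
    · exact sub_eq_zero.1 h
    · exact absurd h hxy
  · intro x y
    simp only [hab]; ring
  · have := Matrix.posSemidef_conjTranspose_mul_self P
    rwa [hH.eq, hI] at this

lemma prob_nonneg {n : Type*} [Fintype n] [DecidableEq n] {P ρ : Matrix n n ℂ}
    (h : IsRankOneProj P) (hρ : ρ.PosSemidef) : 0 ≤ (ρ * P).trace.re := by
  have h1 := (hρ.mul_mul_conjTranspose_same P).trace_nonneg
  rw [h.1.eq, Matrix.trace_mul_comm, ← Matrix.mul_assoc, h.2.1, Matrix.trace_mul_comm] at h1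
  exact (Complex.le_def.1 h1).1

lemma prob_sum {d : ℕ} {P : Fin (d^2) → Matrix (Fin d × Fin d) (Fin d × Fin d) ℂ}
    (hP : IsMeasurement P) {ρ : Matrix (Fin d × Fin d) (Fin d × Fin d) ℂ}
    (hρ : ρ.trace = 1) : ∑ i, (ρ * P i).trace.re = 1 := by
  rw [← Complex.re_sum, ← Matrix.trace_sum, ← Matrix.mul_sum, hP.2.2, Matrix.mul_one, hρ]
  simp

lemma product_state {d : ℕ} {δ : Matrix (Fin d × Fin d) (Fin d × Fin d) ℂ}
    (h : IsProductState δ) : IsState δ := by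
  obtain ⟨A, B, hA, hB, rfl⟩ := h
  refine ⟨hA.1.kronecker hB.1, ?_⟩
  rw [Matrix.trace_kronecker, hA.2, hB.2, one_mul]

lemma klein_nonneg {d : ℕ} {P : Fin (d^2) → Matrix (Fin d × Fin d) (Fin d × Fin d) ℂ}
    (hP : IsMeasurement P) {ρ : Matrix (Fin d × Fin d) (Fin d × Fin d) ℂ}
    (hρ : IsState ρ) : 0 ≤ kleinEntropy ρ P := by
  have h0 : ∀ i, 0 ≤ (ρ * P i).trace.re := fun i => prob_nonneg (hP.1 i) hρ.1
  unfold kleinEntropy shannon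
  refine Finset.sum_nonneg fun i _ => ?_
  have h1 : (ρ * P i).trace.re ≤ 1 := by
    rw [← prob_sum hP hρ.2]
    exact Finset.single_le_sum (f := fun i => (ρ * P i).trace.re)
      (fun j _ => h0 j) (Finset.mem_univ i)
  unfold negMulLog2
  exact neg_nonneg.2 (mul_nonpos_of_nonneg_of_nonpos (h0 i)
    (Real.logb_nonpos (by norm_num) (h0 i) h1))

lemma gibbs_term {p q : ℝ} (hp : 0 ≤ p) (hq : 0 < q) :
    negMulLog2 p ≤ -(p * Real.logb 2 q) + (q - p) / Real.log 2 := by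
  have hl : 0 < Real.log 2 := Real.log_pos (by norm_num)
  unfold negMulLog2 Real.logb
  have key : -(p * Real.log p) ≤ -(p * Real.log q) + (q - p) := by
    rcases hp.eq_or_lt with rfl | hp
    · simpa using hq.le
    · have h1 := Real.log_le_sub_one_of_pos (div_pos hq hp)
      rw [Real.log_div hq.ne' hp.ne'] at h1
      have h2 := mul_le_mul_of_nonneg_left h1 hp.le
      have h3 : p * (q / p - 1) = q - p := by field_simp
      linarith
  have e1 : -(p * (Real.log p / Real.log 2)) = -(p * Real.log p) / Real.log 2 := by ring
  have e2 : -(p * (Real.log q / Real.log 2)) + (q - p) / Real.log 2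
      = (-(p * Real.log q) + (q - p)) / Real.log 2 := by ring
  rw [e1, e2]
  gcongr

lemma entropy_bound {d : ℕ} (hd : 2 ≤ d) (p : Fin (d^2) → ℝ) (h0 : ∀ i, 0 ≤ p i)
    (h1 : ∑ i, p i = 1) (k : Fin (d^2)) (hk : 1 / (d:ℝ) ≤ p k) :
    shannon p ≤ Real.logb 2 d + (1 - 1/(d:ℝ)) * Real.logb 2 ((d:ℝ) + 1) := by
  have hdR : (2:ℝ) ≤ d := by exact_mod_cast hd
  have hd0 : (0:ℝ) < d := by linarith
  have hl1 : 0 ≤ Real.logb 2 ((d:ℝ) + 1) := Real.logb_nonneg (by norm_num) (by linarith)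
  let q : Fin (d^2) → ℝ := fun i => if i = k then 1 / (d:ℝ) else 1 / (d * (d + 1))
  have hq : ∀ i, 0 < q i := by
    intro i; simp only [q]; split_ifs <;> positivity
  have hqs : ∑ i, q i = 1 := by
    rw [← Finset.add_sum_erase _ _ (Finset.mem_univ k)]
    have : ∑ i ∈ Finset.univ.erase k, q i = ∑ i ∈ Finset.univ.erase k, 1 / ((d:ℝ) * (d + 1)) :=
      Finset.sum_congr rfl fun i hi => by simp [q, Finset.ne_of_mem_erase hi]
    rw [this, Finset.sum_const, Finset.card_erase_of_mem (Finset.mem_univ k)]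
    simp only [Finset.card_univ, Fintype.card_fin, nsmul_eq_mul, q, if_true]
    rw [Nat.cast_sub (Nat.one_le_pow _ _ (by omega))]
    push_cast
    field_simp
    ring
  have hlq : ∀ i, -(p i * Real.logb 2 (q i)) =
      p i * Real.logb 2 d + p i * Real.logb 2 (d + 1)
        - (if i = k then p i * Real.logb 2 (d+1) else 0) := by
    intro i
    simp only [q]
    split_ifs
    · rw [one_div, Real.logb_inv]; ring
    · rw [one_div, Real.logb_inv, Real.logb_mul (by positivity) (by positivity)]; ring
  calc shannon p ≤ ∑ i, (-(p i * Real.logb 2 (q i)) + (q i - p i) / Real.log 2) :=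
        Finset.sum_le_sum fun i _ => gibbs_term (h0 i) (hq i)
    _ = Real.logb 2 d + (1 - p k) * Real.logb 2 ((d:ℝ) + 1) := by
        rw [Finset.sum_add_distrib, ← Finset.sum_div, Finset.sum_sub_distrib, hqs, h1]
        simp_rw [hlq]
        rw [Finset.sum_sub_distrib, Finset.sum_add_distrib, ← Finset.sum_mul, ← Finset.sum_mul, h1]
        simp
        ring
    _ ≤ _ := by gcongr

lemma exists_product {d : ℕ} (hd : 2 ≤ d) {P : Matrix (Fin d × Fin d) (Fin d × Fin d) ℂ}
    (h : IsRankOneProj P) :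
    ∃ δ, IsProductState δ ∧ 1 / (d:ℝ) ≤ (δ * P).trace.re := by
  obtain ⟨ht, hm, hps⟩ := rankOne_facts h
  have hd0 : (0:ℝ) < d := by exact_mod_cast (by omega : 0 < d)
  let B : Fin d → Matrix (Fin d) (Fin d) ℂ := fun i => P.submatrix (fun j => (i, j)) (fun j => (i, j))
  have hB : ∀ i, (B i).PosSemidef := fun i => hps.submatrix _
  have hsum : ∑ i, (B i).trace = 1 := by
    rw [← ht, Matrix.trace, Fintype.sum_prod_type]; rfl
  have hsumr : ∑ i, (B i).trace.re = 1 := by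
    rw [← Complex.re_sum, hsum, Complex.one_re]
  have hex : ∃ i, 1 / (d:ℝ) ≤ (B i).trace.re := by
    by_contra hc
    push Not at hc
    have : ∑ i, (B i).trace.re < ∑ i : Fin d, 1 / (d:ℝ) :=
      Finset.sum_lt_sum_of_nonempty ⟨⟨0, by omega⟩, Finset.mem_univ _⟩ fun i _ => hc i
    rw [hsumr, Finset.sum_const] at this
    simp at this
    rw [mul_inv_cancel₀ hd0.ne'] at this
    exact lt_irrefl _ this
  obtain ⟨i, hi⟩ := hex
  have htn := (hB i).trace_nonneg
  have ht0 : (B i).trace ≠ 0 := by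
    intro h0
    rw [h0] at hi
    have : 0 < 1 / (d:ℝ) := by positivity
    simp at hi
    linarith
  refine ⟨(Matrix.single i i 1) ⊗ₖ ((B i).trace⁻¹ • B i),
    ⟨_, _, ⟨?_, ?_⟩, ⟨(hB i).smul (inv_nonneg.2 htn), ?_⟩, rfl⟩, ?_⟩
  · have := Matrix.posSemidef_conjTranspose_mul_self (Matrix.single i i (1:ℂ))
    simpa using this
  · simp
  · rw [Matrix.trace_smul, smul_eq_mul, inv_mul_cancel₀ ht0]
  · suffices hs : ((Matrix.single i i 1) ⊗ₖ ((B i).trace⁻¹ • B i) * P).trace = (B i).trace by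
      rw [hs]; exact hi
    have e : ((Matrix.single i i 1) ⊗ₖ ((B i).trace⁻¹ • B i) * P).trace
        = ∑ y, ∑ w, (B i).trace⁻¹ * (P (i, y) (i, w) * P (i, w) (i, y)) := by
      rw [Matrix.trace, Fintype.sum_prod_type, Finset.sum_eq_single i]
      · refine Finset.sum_congr rfl fun y _ => ?_
        rw [Matrix.diag, Matrix.mul_apply, Fintype.sum_prod_type, Finset.sum_eq_single i]
        · refine Finset.sum_congr rfl fun w _ => ?_
          simp [Matrix.kroneckerMap_apply, B, mul_assoc]
        · intro b _ hb
          simp [Matrix.kroneckerMap_apply, Matrix.single_apply, hb.symm]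
        · simp
      · intro b _ hb
        simp [Matrix.mul_apply, Matrix.kroneckerMap_apply, Matrix.single_apply, hb.symm]
      · simp
    have e2 : ∑ y, ∑ w, P (i, y) (i, y) * P (i, w) (i, w) = (B i).trace * (B i).trace := by
      rw [Matrix.trace, Finset.sum_mul_sum]; rfl
    rw [e]
    simp_rw [hm, ← Finset.mul_sum]
    simp_rw [← Finset.mul_sum] at e2
    rw [e2, ← mul_assoc, inv_mul_cancel₀ ht0, one_mul]

lemma exists_measurement (d : ℕ) :
    ∃ P : Fin (d^2) → Matrix (Fin d × Fin d) (Fin d × Fin d) ℂ, IsMeasurement P := by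
  let e : Fin (d^2) ≃ Fin d × Fin d := (finCongr (pow_two d)).trans finProdFinEquiv.symm
  refine ⟨fun i => Matrix.single (e i) (e i) 1, fun i => ⟨?_, ?_, ?_⟩, ?_, ?_⟩
  · simp [Matrix.IsHermitian]
  · simp
  · beta_reduce
    rw [← Matrix.diagonal_single, Matrix.rank_diagonal]
    rw [Fintype.card_eq_one_iff]
    refine ⟨⟨e i, by simp⟩, ?_⟩
    rintro ⟨y, hy⟩
    by_contra hne
    apply hy
    have : y ≠ e i := fun h => hne (Subtype.ext h)
    simp [this]
  · intro i j hij
    exact Matrix.single_mul_single_of_ne _ _ _ _ (fun h => hij (e.injective h)) _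
  · rw [Equiv.sum_comp e (fun x => Matrix.single x x (1:ℂ))]
    ext x y
    rw [Matrix.sum_apply]
    by_cases h : x = y
    · subst h
      simp [Matrix.single_apply]
    · rw [Matrix.one_apply_ne h]
      refine Finset.sum_eq_zero fun k _ => ?_
      rw [Matrix.single_apply, if_neg]
      rintro ⟨rfl, rfl⟩
      exact h rfl

lemma klein_mixed {d : ℕ} (hd : 2 ≤ d)
    {P : Fin (d^2) → Matrix (Fin d × Fin d) (Fin d × Fin d) ℂ} (hP : IsMeasurement P) :
    kleinEntropy (((d:ℂ)^2)⁻¹ • (1 : Matrix (Fin d × Fin d) (Fin d × Fin d) ℂ)) P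
      = 2 * Real.logb 2 d := by
  have hd0 : (0:ℝ) < d := by exact_mod_cast (by omega : 0 < d)
  unfold kleinEntropy shannon
  have : ∀ i, (((d:ℂ)^2)⁻¹ • (1 : Matrix (Fin d × Fin d) (Fin d × Fin d) ℂ) * P i).trace.re
      = ((d:ℝ)^2)⁻¹ := by
    intro i
    rw [Matrix.smul_mul, Matrix.one_mul, Matrix.trace_smul, (rankOne_facts (hP.1 i)).1,
      smul_eq_mul, mul_one]
    have e : ((d:ℂ)^2)⁻¹ = ((((d:ℝ)^2)⁻¹ : ℝ) : ℂ) := by push_cast; rfl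
    rw [e, Complex.ofReal_re]
  simp_rw [this]
  rw [Finset.sum_const]
  simp only [Finset.card_univ, Fintype.card_fin, nsmul_eq_mul, negMulLog2, Real.logb_inv,
    Real.logb_pow]
  push_cast
  field_simp

lemma bound_neg {d : ℕ} (hd : 2 ≤ d) :
    -Real.logb 2 d + (1 - 1/(d:ℝ)) * Real.logb 2 ((d:ℝ) + 1) < 0 := by
  have hdR : (2:ℝ) ≤ d := by exact_mod_cast hd
  have hd0 : (0:ℝ) < d := by linarith
  have hl : 0 < Real.log 2 := Real.log_pos (by norm_num)
  have h1 : Real.log (d + 1) - Real.log d ≤ 1 / d := by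
    rw [← Real.log_div (by positivity) (by positivity)]
    have := Real.log_le_sub_one_of_pos (show 0 < ((d:ℝ) + 1) / d by positivity)
    have e : ((d:ℝ) + 1) / d - 1 = 1 / d := by field_simp; ring
    linarith
  have h2 : 1 - 1 / (d:ℝ) < Real.log d := by
    have := Real.log_lt_sub_one_of_pos (show 0 < (d:ℝ)⁻¹ by positivity)
      (by intro h; rw [inv_eq_one] at h; linarith)
    rw [Real.log_inv] at this
    rw [one_div]; linarith
  have h3 : 0 < 1 / (d:ℝ) := by positivity
  have h4 : 1 / (d:ℝ) ≤ 1 := by rw [div_le_one hd0]; linarith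
  have h5 : -Real.log d + (1 - 1/(d:ℝ)) * Real.log ((d:ℝ) + 1) < 0 := by
    have a1 := mul_le_mul_of_nonneg_left h1 (sub_nonneg.2 h4)
    have a2 := mul_lt_mul_of_pos_left h2 h3
    linarith
  unfold Real.logb
  have : -(Real.log d / Real.log 2) + (1 - 1/(d:ℝ)) * (Real.log ((d:ℝ) + 1) / Real.log 2)
    = (-Real.log d + (1 - 1/(d:ℝ)) * Real.log ((d:ℝ) + 1)) / Real.log 2 := by ring
  rw [this]
  exact div_neg_of_neg_of_pos h5 hl

/-- For the maximally mixed state I/d² (d ≥ 2),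
M(I/d²) ≤ −log₂ d + (1 − 1/d) log₂(d+1) < 0. -/
theorem stmt4 {d : ℕ} (hd : 2 ≤ d) :
    eep (((d:ℂ)^2)⁻¹ • (1 : Matrix (Fin d × Fin d) (Fin d × Fin d) ℂ)) ≤
        -Real.logb 2 d + (1 - 1/(d:ℝ)) * Real.logb 2 ((d:ℝ) + 1) ∧
      -Real.logb 2 d + (1 - 1/(d:ℝ)) * Real.logb 2 ((d:ℝ) + 1) < 0 := by
  refine ⟨?_, bound_neg hd⟩
  unfold eep
  refine csSup_le ?_ ?_
  · obtain ⟨P, hP⟩ := exists_measurement d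
    exact ⟨_, P, hP, rfl⟩
  · rintro x ⟨P, hP, rfl⟩
    rw [klein_mixed hd hP]
    have hpos : 0 < d ^ 2 := by positivity
    obtain ⟨δ, hδ, hk⟩ := exists_product hd (hP.1 ⟨0, hpos⟩)
    have hst := product_state hδ
    have hb := entropy_bound hd _ (fun i => prob_nonneg (hP.1 i) hst.1) (prob_sum hP hst.2) _ hk
    have hi : infProd P ≤ kleinEntropy δ P := by
      refine csInf_le ⟨0, ?_⟩ ⟨δ, hδ, rfl⟩
      rintro y ⟨δ', hδ', rfl⟩
      exact klein_nonneg hP (product_state hδ')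
    unfold kleinEntropy at hi
    linarith

end EEP
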